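/- Set ω₁(t) = 4i·t/(t⁴+1), ω₂(t) = 2√2·(t²−1)/(t⁴+1), ω₃(t) = 2√2·i·(t²+1)/(t⁴+1) for t ∈ ℝ, and for indices i₁,…,i_n ∈ {1,2,3} let Ω_{i₁,…,i_n} = ∫_{0<t₁<⋯<t_n<1} ω_{i₁}(t₁)⋯ω_{i_n}(t_n) dt₁⋯dt_n denote the iterated integral over the simplex 0 < t₁ < ⋯ < t_n < 1. Then −(i/π³)·Ω_{2,1}³ + (1/(2π²))·Ω_{2,1}·(Ω_{2,2,3} − 6·Ω_{3,1,1} − 3·Ω_{3,3,3}) + (i/(2π))·(6·Ω_{2,1,1,1} + Ω_{2,2,2,1} − Ω_{3,1,2,3} + Ω_{2,1,3,3} + Ω_{3,3,2,1}) = (9/4)·ζ(3), where ζ(3) = ∑_{n=1}^∞ 1/n³. (This quantity is the third coefficient α₃ in the expansion of the area of the Lawson minimal surfaces ξ_{1,g}.) -/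

import Mathlib

/-- The 1-form `ω₁(t) = 4 i t / (t⁴ + 1)` (angle `φ = π/4`). -/
noncomputable def lawsonOmegaForm1 : ℝ → ℂ :=
  fun t => 4 * Complex.I * (t : ℂ) / ((t : ℂ) ^ 4 + 1)

/-- The 1-form `ω₂(t) = 2√2 (t² − 1) / (t⁴ + 1)` (angle `φ = π/4`). -/
noncomputable def lawsonOmegaForm2 : ℝ → ℂ :=
  fun t => ((2 * Real.sqrt 2 * (t ^ 2 - 1) / (t ^ 4 + 1) : ℝ) : ℂ)

/-- The 1-form `ω₃(t) = 2√2 i (t² + 1) / (t⁴ + 1)` (angle `φ = π/4`). -/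
noncomputable def lawsonOmegaForm3 : ℝ → ℂ :=
  fun t => ((2 * Real.sqrt 2 * (t ^ 2 + 1) / (t ^ 4 + 1) : ℝ) : ℂ) * Complex.I

/-- Iterated integral from `0` to `s` of a list of integrands, with the *head* of the
list being the outermost (last) 1-form:
`iterIntAux [] s = 1` and `iterIntAux (f :: fs) s = ∫ t in 0..s, iterIntAux fs t * f t`. -/
noncomputable def iterIntAux : List (ℝ → ℂ) → ℝ → ℂ
  | [], _ => 1
  | f :: fs, s => ∫ t in (0:ℝ)..s, iterIntAux fs t * f t

/-- The iterated integral `Ω_{i₁,…,i_n} = ∫_{0<t₁<⋯<t_n<1} ω_{i₁}(t₁)⋯ω_{i_n}(t_n) dt₁⋯dt_n`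
where the list is given in the order `[ω_{i₁}, …, ω_{i_n}]` (innermost first). -/
noncomputable def OmegaValue (l : List (ℝ → ℂ)) : ℂ := iterIntAux l.reverse 1

/-- The polylogarithm `∑_{n ≥ 1} x ^ n / n ^ k`, as a function on `[-1, 1]`. -/
noncomputable def realPolylog (k : ℕ) (x : ℝ) : ℝ :=
  ∑' n : ℕ, x ^ (n + 1) / ((n : ℝ) + 1) ^ k

lemma summable_one_div_succ_pow {k : ℕ} (hk : 2 ≤ k) :
    Summable fun n : ℕ => 1 / ((n : ℝ) + 1) ^ k := by
  have h := (summable_nat_add_iff 1).2 (Real.summable_one_div_nat_pow.2 hk)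
  simpa using h

lemma norm_realPolylog_term_le (k n : ℕ) {x : ℝ} (hx : x ∈ Set.Icc (-1 : ℝ) 1) :
    ‖x ^ (n + 1) / ((n : ℝ) + 1) ^ k‖ ≤ 1 / ((n : ℝ) + 1) ^ k := by
  have hpos : (0 : ℝ) < ((n : ℝ) + 1) ^ k := by positivity
  rw [norm_div, norm_pow, Real.norm_of_nonneg hpos.le]
  gcongr
  exact pow_le_one₀ (norm_nonneg x) (abs_le.2 hx)

lemma summable_realPolylog {k : ℕ} (hk : 2 ≤ k) {x : ℝ} (hx : x ∈ Set.Icc (-1 : ℝ) 1) :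
    Summable fun n : ℕ => x ^ (n + 1) / ((n : ℝ) + 1) ^ k :=
  .of_norm_bounded (summable_one_div_succ_pow hk) fun n => norm_realPolylog_term_le k n hx

lemma continuousOn_realPolylog {k : ℕ} (hk : 2 ≤ k) :
    ContinuousOn (realPolylog k) (Set.Icc (-1) 1) :=
  continuousOn_tsum (fun n => by fun_prop) (summable_one_div_succ_pow hk)
    fun n _ hx => norm_realPolylog_term_le k n hx

@[simp]
lemma realPolylog_zero_right (k : ℕ) : realPolylog k 0 = 0 := by
  simp [realPolylog]

lemma realPolylog_one_left {x : ℝ} (hx : |x| < 1) : realPolylog 1 x = -Real.log (1 - x) := by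
  simpa [realPolylog] using (Real.hasSum_pow_div_log_of_abs_lt_one hx).tsum_eq

lemma hasDerivAt_realPolylog_succ (k : ℕ) {x : ℝ} (hx : |x| < 1) (hx₀ : x ≠ 0) :
    HasDerivAt (realPolylog (k + 1)) (realPolylog k x / x) x := by
  obtain ⟨r, hxr, hr⟩ := exists_between hx
  have hr₀ : 0 < r := (abs_nonneg x).trans_lt hxr
  have key := hasDerivAt_tsum_of_isPreconnected (𝕜 := ℝ) (t := Metric.ball (0 : ℝ) r)
    (g := fun (n : ℕ) y => y ^ (n + 1) / ((n : ℝ) + 1) ^ (k + 1))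
    (g' := fun (n : ℕ) y => y ^ n / ((n : ℝ) + 1) ^ k) (y₀ := 0) (y := x)
    (summable_geometric_of_lt_one hr₀.le hr) Metric.isOpen_ball
    (convex_ball (0 : ℝ) r).isPreconnected ?_ ?_ (Metric.mem_ball_self hr₀) ?_ (by simpa using hxr)
  · refine key.congr_deriv ?_
    rw [realPolylog, ← tsum_div_const]
    refine tsum_congr fun n => ?_
    field_simp
    ring
  · intro n y _
    have hn : (n : ℝ) + 1 ≠ 0 := by positivity
    refine ((hasDerivAt_pow (n + 1) y).div_const _).congr_deriv ?_
    push_cast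
    field_simp
    ring
  · intro n y hy
    have hy' : |y| < r := by simpa using hy
    have h1 : (1 : ℝ) ≤ ((n : ℝ) + 1) ^ k := one_le_pow₀ (by linarith [n.cast_nonneg (α := ℝ)])
    rw [norm_div, norm_pow, Real.norm_of_nonneg (zero_le_one.trans h1), Real.norm_eq_abs]
    calc |y| ^ n / ((n : ℝ) + 1) ^ k ≤ |y| ^ n := div_le_self (by positivity) h1
      _ ≤ r ^ n := by gcongr
  · simp

lemma realPolylog_two_mul_neg_one {k : ℕ} (hk : 2 ≤ k) :
    2 ^ k * (realPolylog k 1 + realPolylog k (-1)) = 2 * realPolylog k 1 := by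
  have h1 := summable_realPolylog hk (x := 1) (by norm_num)
  have h2 := summable_realPolylog hk (x := -1) (by norm_num)
  have hodd : HasSum (fun m : ℕ => (1 : ℝ) ^ (2 * m + 1 + 1) / (((2 * m + 1 : ℕ) : ℝ) + 1) ^ k
      + (-1 : ℝ) ^ (2 * m + 1 + 1) / (((2 * m + 1 : ℕ) : ℝ) + 1) ^ k)
      (2 / 2 ^ k * realPolylog k 1) := by
    refine (h1.hasSum.mul_left (2 / 2 ^ k : ℝ)).congr_fun ?_
    intro m
    have : ((2 * m + 1 : ℕ) : ℝ) + 1 = 2 * ((m : ℝ) + 1) := by push_cast; ring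
    have hsign : (-1 : ℝ) ^ (2 * m + 1 + 1) = 1 := Even.neg_one_pow ⟨m + 1, by ring⟩
    rw [this, mul_pow, hsign, one_pow, one_pow]
    field_simp
    norm_num
  have heven : HasSum (fun m : ℕ => (1 : ℝ) ^ (2 * m + 1) / (((2 * m : ℕ) : ℝ) + 1) ^ k
      + (-1 : ℝ) ^ (2 * m + 1) / (((2 * m : ℕ) : ℝ) + 1) ^ k) 0 := by
    refine hasSum_zero.congr_fun fun m => ?_
    have : (-1 : ℝ) ^ (2 * m + 1) = -1 := Odd.neg_one_pow ⟨m, rfl⟩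
    rw [this]
    simp [neg_div]
  have h := (h1.hasSum.add h2.hasSum).unique (HasSum.even_add_odd
    (f := fun n : ℕ => (1 : ℝ) ^ (n + 1) / ((n : ℝ) + 1) ^ k
      + (-1 : ℝ) ^ (n + 1) / ((n : ℝ) + 1) ^ k) heven hodd)
  change realPolylog k 1 + realPolylog k (-1) = _ at h
  rw [h]
  field_simp
  ring

lemma realPolylog_one_right (k : ℕ) : realPolylog k 1 = ∑' n : ℕ, 1 / ((n : ℝ) + 1) ^ k := by
  simp [realPolylog]

lemma realPolylog_two_one : realPolylog 2 1 = Real.pi ^ 2 / 6 := by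
  rw [realPolylog_one_right, ← hasSum_zeta_two.tsum_eq,
    hasSum_zeta_two.summable.tsum_eq_zero_add]
  simp

lemma realPolylog_two_neg_one : realPolylog 2 (-1) = -(Real.pi ^ 2 / 12) := by
  have h := realPolylog_two_mul_neg_one (k := 2) le_rfl
  rw [realPolylog_two_one] at h
  linarith

lemma realPolylog_three_neg_one : realPolylog 3 (-1) = -(3 / 4) * realPolylog 3 1 := by
  have h := realPolylog_two_mul_neg_one (k := 3) (by norm_num)
  linarith

lemma eq_of_hasDerivAt_eq {a b : ℝ} (hab : a < b) {f g f' : ℝ → ℝ}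
    (hf : ContinuousOn f (Set.Icc a b)) (hg : ContinuousOn g (Set.Icc a b))
    (hf' : ∀ x ∈ Set.Ioo a b, HasDerivAt f (f' x) x)
    (hg' : ∀ x ∈ Set.Ioo a b, HasDerivAt g (f' x) x) (ha : f a = g a) : f b = g b := by
  obtain ⟨c, hc, h⟩ := exists_hasDerivAt_eq_slope (fun x => f x - g x) (fun x => f' x - f' x) hab
    (hf.sub hg) fun x hx => (hf' x hx).sub (hg' x hx)
  rw [sub_self, eq_comm, div_eq_zero_iff] at h
  rcases h with h | h <;> linarith

lemma hasDerivAt_intervalIntegral_of_continuous {F F' : ℝ → ℝ → ℝ}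
    (hF : Continuous fun x : ℝ × ℝ => F x.1 x.2) (hF' : Continuous fun x : ℝ × ℝ => F' x.1 x.2)
    (h : ∀ p x, HasDerivAt (fun q => F q x) (F' p x) p) (a b p : ℝ) :
    HasDerivAt (fun q => ∫ x in a..b, F q x) (∫ x in a..b, F' p x) p := by
  have hsec : ∀ q, Continuous (F q) := fun q => hF.comp (.prodMk_right q)
  have hsec' : ∀ q, Continuous (F' q) := fun q => hF'.comp (.prodMk_right q)
  obtain ⟨M, hM⟩ := ((isCompact_closedBall p 1).prod
    (isCompact_uIcc (a := a) (b := b))).exists_bound_of_continuousOn hF'.continuousOn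
  refine (intervalIntegral.hasDerivAt_integral_of_dominated_loc_of_deriv_le
    (bound := fun _ => M) (Metric.closedBall_mem_nhds p one_pos)
    (.of_forall fun q => (hsec q).aestronglyMeasurable) ((hsec p).intervalIntegrable a b)
    (hsec' p).aestronglyMeasurable (.of_forall fun x hx q hq => ?_) (by simp)
    (.of_forall fun x _ q _ => h q x)).2
  exact hM (q, x) ⟨hq, Set.uIoc_subset_uIcc hx⟩

/-- The square root `√(1 + p² sin² γ)`. -/
noncomputable def lawsonRoot (p γ : ℝ) : ℝ := √(1 + p ^ 2 * Real.sin γ ^ 2)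

/-- The function `β`. At `p = 1` and in the coordinate `γ`, it is `-1 / 2` times the primitive of
the second form that vanishes at `0`. -/
noncomputable def lawsonBeta (p γ : ℝ) : ℝ := Real.arsinh (p * Real.sin γ)

/-- The function `θ`. At `p = 1` and in the coordinate `γ`, it is `i / 2` times the primitive of
the first form that vanishes at `π / 2`. -/
noncomputable def lawsonTheta (p γ : ℝ) : ℝ := Real.arctan (p * Real.cos γ / lawsonRoot p γ)

lemma one_add_sq_mul_sin_sq_pos (p γ : ℝ) : 0 < 1 + p ^ 2 * Real.sin γ ^ 2 := by positivity

lemma lawsonRoot_pos (p γ : ℝ) : 0 < lawsonRoot p γ :=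
  Real.sqrt_pos.2 (one_add_sq_mul_sin_sq_pos p γ)

lemma lawsonRoot_ne_zero (p γ : ℝ) : lawsonRoot p γ ≠ 0 := (lawsonRoot_pos p γ).ne'

lemma lawsonRoot_sq (p γ : ℝ) : lawsonRoot p γ ^ 2 = 1 + p ^ 2 * Real.sin γ ^ 2 :=
  Real.sq_sqrt (one_add_sq_mul_sin_sq_pos p γ).le

section Continuity

variable {X : Type*} [TopologicalSpace X] {f g : X → ℝ}

@[fun_prop]
lemma Continuous.lawsonRoot (hf : Continuous f) (hg : Continuous g) :
    Continuous fun x => lawsonRoot (f x) (g x) := by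
  unfold _root_.lawsonRoot
  fun_prop

@[fun_prop]
lemma Continuous.lawsonBeta (hf : Continuous f) (hg : Continuous g) :
    Continuous fun x => lawsonBeta (f x) (g x) :=
  Real.continuous_arsinh.comp (hf.mul (Real.continuous_sin.comp hg))

@[fun_prop]
lemma Continuous.lawsonTheta (hf : Continuous f) (hg : Continuous g) :
    Continuous fun x => lawsonTheta (f x) (g x) :=
  Real.continuous_arctan.comp <| (hf.mul (Real.continuous_cos.comp hg)).div (hf.lawsonRoot hg)
    fun _ => lawsonRoot_ne_zero _ _

@[fun_prop]
lemma Continuous.div_lawsonRoot {h : X → ℝ} (hh : Continuous h) (hf : Continuous f)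
    (hg : Continuous g) : Continuous fun x => h x / _root_.lawsonRoot (f x) (g x) :=
  hh.div (hf.lawsonRoot hg) fun _ => lawsonRoot_ne_zero _ _

@[fun_prop]
lemma Continuous.div_lawsonRoot_pow {h : X → ℝ} (hh : Continuous h) (hf : Continuous f)
    (hg : Continuous g) (n : ℕ) : Continuous fun x => h x / _root_.lawsonRoot (f x) (g x) ^ n :=
  hh.div ((hf.lawsonRoot hg).pow n) fun _ => pow_ne_zero n (lawsonRoot_ne_zero _ _)

end Continuity

lemma hasDerivAt_lawsonRoot_left (p γ : ℝ) :
    HasDerivAt (fun q => lawsonRoot q γ) (p * Real.sin γ ^ 2 / lawsonRoot p γ) p := by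
  refine ((((hasDerivAt_pow 2 p).mul_const _).const_add 1).sqrt
    (one_add_sq_mul_sin_sq_pos p γ).ne').congr_deriv ?_
  rw [← lawsonRoot]
  have := lawsonRoot_ne_zero p γ
  field_simp
  norm_num
  ring

lemma hasDerivAt_lawsonRoot (p γ : ℝ) :
    HasDerivAt (lawsonRoot p) (p ^ 2 * Real.sin γ * Real.cos γ / lawsonRoot p γ) γ := by
  refine (((((Real.hasDerivAt_sin γ).pow 2).const_mul (p ^ 2)).const_add 1).sqrt
    (one_add_sq_mul_sin_sq_pos p γ).ne').congr_deriv ?_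
  simp only [Pi.pow_apply]
  rw [← lawsonRoot]
  have := lawsonRoot_ne_zero p γ
  field_simp
  norm_num
  ring

lemma hasDerivAt_lawsonBeta_left (p γ : ℝ) :
    HasDerivAt (fun q => lawsonBeta q γ) (Real.sin γ / lawsonRoot p γ) p := by
  refine ((hasDerivAt_id p).mul_const (Real.sin γ)).arsinh.congr_deriv ?_
  simp only [id, mul_pow, lawsonRoot, smul_eq_mul]
  ring

lemma hasDerivAt_lawsonBeta (p γ : ℝ) :
    HasDerivAt (lawsonBeta p) (p * (Real.cos γ / lawsonRoot p γ)) γ := by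
  refine ((Real.hasDerivAt_sin γ).const_mul p).arsinh.congr_deriv ?_
  simp only [mul_pow, lawsonRoot, smul_eq_mul]
  ring

lemma hasDerivAt_cos_div_lawsonRoot (p γ : ℝ) :
    HasDerivAt (fun x => Real.cos x / lawsonRoot p x)
      (-((1 + p ^ 2) * (Real.sin γ / lawsonRoot p γ ^ 3))) γ := by
  have h0 := lawsonRoot_ne_zero p γ
  have hsq := lawsonRoot_sq p γ
  refine ((Real.hasDerivAt_cos γ).div (hasDerivAt_lawsonRoot p γ) h0).congr_deriv ?_
  field_simp
  linear_combination (-Real.sin γ) * hsq - p ^ 2 * Real.sin γ * Real.sin_sq_add_cos_sq γ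

lemma one_add_sq_tan_lawsonTheta (p γ : ℝ) :
    1 + (p * Real.cos γ / lawsonRoot p γ) ^ 2 = (1 + p ^ 2) / lawsonRoot p γ ^ 2 := by
  have h0 := lawsonRoot_ne_zero p γ
  have hsq := lawsonRoot_sq p γ
  field_simp
  linear_combination hsq + p ^ 2 * Real.sin_sq_add_cos_sq γ

lemma hasDerivAt_lawsonTheta (p γ : ℝ) :
    HasDerivAt (lawsonTheta p) (-(p * (Real.sin γ / lawsonRoot p γ))) γ := by
  have h0 := lawsonRoot_ne_zero p γ
  have hp : 1 + p ^ 2 ≠ 0 := by positivity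
  have h := ((hasDerivAt_cos_div_lawsonRoot p γ).const_mul p).arctan
  simp only [← mul_div_assoc, one_add_sq_tan_lawsonTheta] at h
  refine h.congr_deriv ?_
  field_simp

lemma hasDerivAt_lawsonTheta_left (p γ : ℝ) :
    HasDerivAt (fun q => lawsonTheta q γ) (Real.cos γ / lawsonRoot p γ / (1 + p ^ 2)) p := by
  have h0 := lawsonRoot_ne_zero p γ
  have hsq := lawsonRoot_sq p γ
  have hp : 1 + p ^ 2 ≠ 0 := by positivity
  have h := (((hasDerivAt_id p).mul_const (Real.cos γ)).div (hasDerivAt_lawsonRoot_left p γ)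
    h0).arctan
  simp only [id, Pi.div_apply, one_add_sq_tan_lawsonTheta] at h
  refine h.congr_deriv ?_
  field_simp
  linear_combination Real.cos γ * hsq

lemma hasDerivAt_mul_sin_div_lawsonRoot_left (p γ : ℝ) :
    HasDerivAt (fun q => q * (Real.sin γ / lawsonRoot q γ))
      (Real.sin γ / lawsonRoot p γ ^ 3) p := by
  have h0 := lawsonRoot_ne_zero p γ
  have hsq := lawsonRoot_sq p γ
  refine ((hasDerivAt_id p).mul ((hasDerivAt_const p (Real.sin γ)).div
    (hasDerivAt_lawsonRoot_left p γ) h0)).congr_deriv ?_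
  simp only [id, Pi.div_apply]
  field_simp
  linear_combination Real.sin γ * hsq

lemma sin_sq_add_cos_sq_div_lawsonRoot (p γ : ℝ) :
    (Real.sin γ / lawsonRoot p γ) ^ 2 + (Real.cos γ / lawsonRoot p γ) ^ 2 / (1 + p ^ 2)
      = 1 / (1 + p ^ 2) := by
  have h0 := lawsonRoot_ne_zero p γ
  have hp : 1 + p ^ 2 ≠ 0 := by positivity
  field_simp
  linear_combination Real.sin_sq_add_cos_sq γ - lawsonRoot_sq p γ

@[simp] lemma lawsonBeta_zero_left (γ : ℝ) : lawsonBeta 0 γ = 0 := by simp [lawsonBeta]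

@[simp] lemma lawsonBeta_zero_right (p : ℝ) : lawsonBeta p 0 = 0 := by simp [lawsonBeta]

@[simp] lemma lawsonTheta_zero_left (γ : ℝ) : lawsonTheta 0 γ = 0 := by simp [lawsonTheta]

@[simp] lemma lawsonTheta_pi_div_two (p : ℝ) : lawsonTheta p (Real.pi / 2) = 0 := by
  simp [lawsonTheta]

lemma integral_eq_sub_of_hasDerivAt_of_continuous {G g : ℝ → ℝ}
    (hG : ∀ x, HasDerivAt G (g x) x) (hg : Continuous g) (a b : ℝ) :
    ∫ x in a..b, g x = G b - G a :=
  intervalIntegral.integral_eq_sub_of_hasDerivAt (fun x _ => hG x) (hg.intervalIntegrable a b)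

lemma hasDerivAt_log_one_add_sq (p : ℝ) :
    HasDerivAt (fun q : ℝ => Real.log (1 + q ^ 2)) (2 * p / (1 + p ^ 2)) p := by
  refine (((hasDerivAt_pow 2 p).const_add 1).log (by positivity)).congr_deriv ?_
  simp

section ParameterIntegrals

/-- The integral `∫ β u` over `[0, π / 2]`, where `u = p sin γ / √(1 + p² sin² γ)`. -/
noncomputable def integralBeta (p : ℝ) : ℝ :=
  ∫ γ in (0 : ℝ)..(Real.pi / 2), lawsonBeta p γ * (p * (Real.sin γ / lawsonRoot p γ))

/-- The integral `∫ β²` over `[0, π / 2]`. -/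
noncomputable def integralBetaSq (p : ℝ) : ℝ :=
  ∫ γ in (0 : ℝ)..(Real.pi / 2), lawsonBeta p γ ^ 2

/-- The integral `∫ θ²` over `[0, π / 2]`. -/
noncomputable def integralThetaSq (p : ℝ) : ℝ :=
  ∫ γ in (0 : ℝ)..(Real.pi / 2), lawsonTheta p γ ^ 2

/-- The integral `∫ β³ u` over `[0, π / 2]`. -/
noncomputable def integralBetaCube (p : ℝ) : ℝ :=
  ∫ γ in (0 : ℝ)..(Real.pi / 2), lawsonBeta p γ ^ 3 * (p * (Real.sin γ / lawsonRoot p γ))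

/-- The integral `∫ β θ² u` over `[0, π / 2]`. -/
noncomputable def integralBetaThetaSq (p : ℝ) : ℝ :=
  ∫ γ in (0 : ℝ)..(Real.pi / 2),
    lawsonBeta p γ * lawsonTheta p γ ^ 2 * (p * (Real.sin γ / lawsonRoot p γ))

/-- The primitive of `θ` that vanishes at `0`. -/
noncomputable def primitiveTheta (p γ : ℝ) : ℝ := ∫ x in (0 : ℝ)..γ, lawsonTheta p x

/-- The integral `∫ β e` over `[0, π / 2]`, where `e` is the primitive of `θ`. -/
noncomputable def integralBetaPrimitive (p : ℝ) : ℝ :=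
  ∫ γ in (0 : ℝ)..(Real.pi / 2), lawsonBeta p γ * primitiveTheta p γ

lemma hasDerivAt_primitiveTheta (p γ : ℝ) :
    HasDerivAt (primitiveTheta p) (lawsonTheta p γ) γ :=
  (continuous_const.lawsonTheta continuous_id).integral_hasStrictDerivAt 0 γ |>.hasDerivAt

lemma continuous_primitiveTheta : Continuous fun x : ℝ × ℝ => primitiveTheta x.1 x.2 :=
  intervalIntegral.continuous_parametric_intervalIntegral_of_continuous
    (f := fun (x : ℝ × ℝ) t => lawsonTheta x.1 t) (by fun_prop) continuous_snd

@[simp]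
lemma primitiveTheta_zero_right (p : ℝ) : primitiveTheta p 0 = 0 := by simp [primitiveTheta]

lemma hasDerivAt_integralBeta (p : ℝ) :
    HasDerivAt integralBeta (Real.pi / 2 * (p / (1 + p ^ 2))) p := by
  have hp : 1 + p ^ 2 ≠ 0 := by positivity
  refine (hasDerivAt_intervalIntegral_of_continuous (F' := fun p γ =>
    Real.sin γ / lawsonRoot p γ * (p * (Real.sin γ / lawsonRoot p γ))
      + lawsonBeta p γ * (Real.sin γ / lawsonRoot p γ ^ 3)) (by fun_prop) (by fun_prop)
    (fun p γ => (hasDerivAt_lawsonBeta_left p γ).fun_mul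
      (hasDerivAt_mul_sin_div_lawsonRoot_left p γ))
    0 (Real.pi / 2) p).congr_deriv ?_
  rw [integral_eq_sub_of_hasDerivAt_of_continuous (G := fun γ =>
    γ * (p / (1 + p ^ 2)) - lawsonBeta p γ * (Real.cos γ / lawsonRoot p γ) / (1 + p ^ 2)) _
    (by fun_prop)]
  · simp
  · intro γ
    refine (((hasDerivAt_id γ).mul_const _).sub (((hasDerivAt_lawsonBeta p γ).mul
      (hasDerivAt_cos_div_lawsonRoot p γ)).div_const _)).congr_deriv ?_
    have key := sin_sq_add_cos_sq_div_lawsonRoot p γ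
    generalize Real.sin γ / lawsonRoot p γ ^ 3 = R at *
    generalize Real.sin γ / lawsonRoot p γ = S at *
    generalize Real.cos γ / lawsonRoot p γ = C at *
    field_simp at key ⊢
    linear_combination (-p) * key

lemma hasDerivAt_integralBetaCube (p : ℝ) :
    HasDerivAt integralBetaCube (3 * (p / (1 + p ^ 2)) * integralBetaSq p) p := by
  have hp : 1 + p ^ 2 ≠ 0 := by positivity
  refine (hasDerivAt_intervalIntegral_of_continuous (F' := fun p γ =>
    3 * lawsonBeta p γ ^ 2 * (Real.sin γ / lawsonRoot p γ) * (p * (Real.sin γ / lawsonRoot p γ))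
      + lawsonBeta p γ ^ 3 * (Real.sin γ / lawsonRoot p γ ^ 3)) (by fun_prop) (by fun_prop)
    (fun p γ => ((hasDerivAt_lawsonBeta_left p γ).pow 3).mul
      (hasDerivAt_mul_sin_div_lawsonRoot_left p γ)) 0 (Real.pi / 2) p).congr_deriv ?_
  rw [integralBetaSq, ← intervalIntegral.integral_const_mul, ← sub_eq_zero,
    ← intervalIntegral.integral_sub (by apply Continuous.intervalIntegrable; fun_prop)
      (by apply Continuous.intervalIntegrable; fun_prop),
    integral_eq_sub_of_hasDerivAt_of_continuous (G := fun γ =>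
      -(lawsonBeta p γ ^ 3 * (Real.cos γ / lawsonRoot p γ) / (1 + p ^ 2))) _ (by fun_prop)]
  · simp
  · intro γ
    refine ((((hasDerivAt_lawsonBeta p γ).pow 3).mul
      (hasDerivAt_cos_div_lawsonRoot p γ)).div_const _).neg.congr_deriv ?_
    have key := sin_sq_add_cos_sq_div_lawsonRoot p γ
    simp only [Pi.pow_apply]
    generalize Real.sin γ / lawsonRoot p γ ^ 3 = R at *
    generalize Real.sin γ / lawsonRoot p γ = S at *
    generalize Real.cos γ / lawsonRoot p γ = C at *
    field_simp at key ⊢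
    linear_combination (-3 * p * lawsonBeta p γ ^ 2) * key

lemma hasDerivAt_integralBetaThetaSq (p : ℝ) :
    HasDerivAt integralBetaThetaSq (p / (1 + p ^ 2) * integralThetaSq p) p := by
  have hp : 1 + p ^ 2 ≠ 0 := by positivity
  refine (hasDerivAt_intervalIntegral_of_continuous (F' := fun p γ =>
    (Real.sin γ / lawsonRoot p γ * lawsonTheta p γ ^ 2 + lawsonBeta p γ *
      (2 * lawsonTheta p γ * (Real.cos γ / lawsonRoot p γ / (1 + p ^ 2))))
        * (p * (Real.sin γ / lawsonRoot p γ))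
      + lawsonBeta p γ * lawsonTheta p γ ^ 2 * (Real.sin γ / lawsonRoot p γ ^ 3))
    (by fun_prop) (by fun_prop (disch := intro; positivity))
    (fun p γ => ?_) 0 (Real.pi / 2) p).congr_deriv ?_
  · refine (((hasDerivAt_lawsonBeta_left p γ).mul ((hasDerivAt_lawsonTheta_left p γ).pow 2)).mul
      (hasDerivAt_mul_sin_div_lawsonRoot_left p γ)).congr_deriv ?_
    simp
  rw [integralThetaSq, ← intervalIntegral.integral_const_mul, ← sub_eq_zero,
    ← intervalIntegral.integral_sub (by apply Continuous.intervalIntegrable; fun_prop)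
      (by apply Continuous.intervalIntegrable; fun_prop),
    integral_eq_sub_of_hasDerivAt_of_continuous (G := fun γ =>
      -(lawsonBeta p γ * lawsonTheta p γ ^ 2 * (Real.cos γ / lawsonRoot p γ) / (1 + p ^ 2))) _
      (by fun_prop)]
  · simp
  · intro γ
    refine ((((hasDerivAt_lawsonBeta p γ).mul ((hasDerivAt_lawsonTheta p γ).pow 2)).mul
      (hasDerivAt_cos_div_lawsonRoot p γ)).div_const _).neg.congr_deriv ?_
    have key := sin_sq_add_cos_sq_div_lawsonRoot p γ
    simp only [Pi.pow_apply, Pi.mul_apply]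
    generalize Real.sin γ / lawsonRoot p γ ^ 3 = R at *
    generalize Real.sin γ / lawsonRoot p γ = S at *
    generalize Real.cos γ / lawsonRoot p γ = C at *
    field_simp at key ⊢
    linear_combination (-p * lawsonTheta p γ ^ 2) * key

lemma hasDerivAt_integralBetaSq {p : ℝ} (hp : p ≠ 0) :
    HasDerivAt integralBetaSq (2 / p * integralBeta p) p := by
  refine (hasDerivAt_intervalIntegral_of_continuous (F' := fun p γ =>
    2 * lawsonBeta p γ * (Real.sin γ / lawsonRoot p γ)) (by fun_prop) (by fun_prop)
    (fun p γ => by simpa using (hasDerivAt_lawsonBeta_left p γ).fun_pow 2)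
    0 (Real.pi / 2) p).congr_deriv ?_
  rw [integralBeta, ← intervalIntegral.integral_const_mul]
  congr 1
  ext γ
  field_simp

lemma integral_lawsonTheta_mul_cos (p : ℝ) :
    ∫ γ in (0 : ℝ)..(Real.pi / 2), lawsonTheta p γ * (p * (Real.cos γ / lawsonRoot p γ))
      = integralBeta p := by
  rw [integralBeta, ← sub_eq_zero,
    ← intervalIntegral.integral_sub (by apply Continuous.intervalIntegrable; fun_prop)
      (by apply Continuous.intervalIntegrable; fun_prop),
    integral_eq_sub_of_hasDerivAt_of_continuous (G := fun γ => lawsonTheta p γ * lawsonBeta p γ) _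
      (by fun_prop)]
  · simp
  · intro γ
    refine ((hasDerivAt_lawsonTheta p γ).mul (hasDerivAt_lawsonBeta p γ)).congr_deriv ?_
    ring

lemma hasDerivAt_integralThetaSq {p : ℝ} (hp : p ≠ 0) :
    HasDerivAt integralThetaSq (2 / (p * (1 + p ^ 2)) * integralBeta p) p := by
  have hp' : 1 + p ^ 2 ≠ 0 := by positivity
  refine (hasDerivAt_intervalIntegral_of_continuous (F' := fun p γ =>
    2 * lawsonTheta p γ * (Real.cos γ / lawsonRoot p γ / (1 + p ^ 2))) (by fun_prop)
    (by fun_prop (disch := intro; positivity))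
    (fun p γ => by simpa using (hasDerivAt_lawsonTheta_left p γ).fun_pow 2)
    0 (Real.pi / 2) p).congr_deriv ?_
  rw [← integral_lawsonTheta_mul_cos, ← intervalIntegral.integral_const_mul]
  congr 1
  ext γ
  field_simp

lemma integral_cos_div_lawsonRoot {p : ℝ} (hp : p ≠ 0) (γ : ℝ) :
    ∫ x in (0 : ℝ)..γ, Real.cos x / lawsonRoot p x / (1 + p ^ 2)
      = lawsonBeta p γ / (p * (1 + p ^ 2)) := by
  rw [integral_eq_sub_of_hasDerivAt_of_continuous
    (G := fun x => lawsonBeta p x / (p * (1 + p ^ 2))) _ (by fun_prop)]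
  · simp
  · intro x
    refine ((hasDerivAt_lawsonBeta p x).div_const _).congr_deriv ?_
    field_simp

lemma integral_sin_mul_primitiveTheta (p : ℝ) :
    ∫ γ in (0 : ℝ)..(Real.pi / 2), p * (Real.sin γ / lawsonRoot p γ) * primitiveTheta p γ
      = integralThetaSq p := by
  have hc : Continuous (primitiveTheta p) := continuous_primitiveTheta.comp (.prodMk_right p)
  rw [integralThetaSq, eq_comm, ← sub_eq_zero,
    ← intervalIntegral.integral_sub (by apply Continuous.intervalIntegrable; fun_prop)
      (by apply Continuous.intervalIntegrable; fun_prop),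
    integral_eq_sub_of_hasDerivAt_of_continuous
      (G := fun γ => lawsonTheta p γ * primitiveTheta p γ) _ (by fun_prop)]
  · simp
  · intro γ
    refine ((hasDerivAt_lawsonTheta p γ).mul (hasDerivAt_primitiveTheta p γ)).congr_deriv ?_
    ring

lemma hasDerivAt_integralBetaPrimitive {p : ℝ} (hp : p ≠ 0) :
    HasDerivAt integralBetaPrimitive
      ((integralThetaSq p + integralBetaSq p / (1 + p ^ 2)) / p) p := by
  have hp' : 1 + p ^ 2 ≠ 0 := by positivity
  have hc := continuous_primitiveTheta
  have hc' : Continuous (primitiveTheta p) := continuous_primitiveTheta.comp (.prodMk_right p)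
  have hd : Continuous fun x : ℝ × ℝ =>
      ∫ t in (0 : ℝ)..x.2, Real.cos t / lawsonRoot x.1 t / (1 + x.1 ^ 2) :=
    intervalIntegral.continuous_parametric_intervalIntegral_of_continuous
      (f := fun (x : ℝ × ℝ) t => Real.cos t / lawsonRoot x.1 t / (1 + x.1 ^ 2))
      (by fun_prop (disch := intro; positivity)) continuous_snd
  refine (hasDerivAt_intervalIntegral_of_continuous (F' := fun p γ =>
    Real.sin γ / lawsonRoot p γ * primitiveTheta p γ + lawsonBeta p γ *
      ∫ t in (0 : ℝ)..γ, Real.cos t / lawsonRoot p t / (1 + p ^ 2)) (by fun_prop) (by fun_prop)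
    (fun p γ => (hasDerivAt_lawsonBeta_left p γ).fun_mul
      (hasDerivAt_intervalIntegral_of_continuous (by fun_prop)
        (by fun_prop (disch := intro; positivity)) hasDerivAt_lawsonTheta_left 0 γ p))
    0 (Real.pi / 2) p).congr_deriv ?_
  simp only [integral_cos_div_lawsonRoot hp]
  rw [← integral_sin_mul_primitiveTheta, integralBetaSq, ← intervalIntegral.integral_div,
    ← intervalIntegral.integral_add (by apply Continuous.intervalIntegrable; fun_prop)
      (by apply Continuous.intervalIntegrable; fun_prop), ← intervalIntegral.integral_div]
  congr 1
  ext γ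
  field_simp

lemma continuous_integralBetaSq : Continuous integralBetaSq :=
  intervalIntegral.continuous_parametric_intervalIntegral_of_continuous' (by fun_prop) _ _

lemma continuous_integralThetaSq : Continuous integralThetaSq :=
  intervalIntegral.continuous_parametric_intervalIntegral_of_continuous' (by fun_prop) _ _

lemma continuous_integralBetaPrimitive : Continuous integralBetaPrimitive := by
  have hc := continuous_primitiveTheta
  exact intervalIntegral.continuous_parametric_intervalIntegral_of_continuous'
    (f := fun p γ => lawsonBeta p γ * primitiveTheta p γ) (by fun_prop) _ _

lemma continuous_integralBetaCube : Continuous integralBetaCube :=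
  continuous_iff_continuousAt.2 fun p => (hasDerivAt_integralBetaCube p).continuousAt

lemma continuous_integralBetaThetaSq : Continuous integralBetaThetaSq :=
  continuous_iff_continuousAt.2 fun p => (hasDerivAt_integralBetaThetaSq p).continuousAt

lemma integralBeta_eq {p : ℝ} (hp : 0 < p) :
    integralBeta p = Real.pi / 4 * Real.log (1 + p ^ 2) := by
  refine eq_of_hasDerivAt_eq (f := integralBeta)
    (g := fun p => Real.pi / 4 * Real.log (1 + p ^ 2)) hp
    (fun x _ => (hasDerivAt_integralBeta x).continuousAt.continuousWithinAt)
    (fun x _ => ((hasDerivAt_log_one_add_sq x).const_mul _).continuousAt.continuousWithinAt)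
    (fun x _ => hasDerivAt_integralBeta x)
    (fun x _ => ((hasDerivAt_log_one_add_sq x).const_mul _).congr_deriv (by ring)) ?_
  simp [integralBeta]

end ParameterIntegrals

section Evaluation

lemma hasDerivAt_realPolylog_neg_sq (k : ℕ) {p : ℝ} (h₀ : 0 < p) (h₁ : p < 1) :
    HasDerivAt (fun q : ℝ => realPolylog (k + 1) (-q ^ 2)) (2 / p * realPolylog k (-p ^ 2)) p := by
  have h : |-p ^ 2| < 1 := by rw [abs_neg, abs_of_pos (by positivity)]; nlinarith
  refine ((hasDerivAt_realPolylog_succ k h (by simp [h₀.ne'])).comp p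
    (hasDerivAt_pow 2 p).neg).congr_deriv ?_
  field_simp
  norm_num
  ring

lemma hasDerivAt_realPolylog_sq_div (k : ℕ) {p : ℝ} (h₀ : 0 < p) :
    HasDerivAt (fun q : ℝ => realPolylog (k + 1) (q ^ 2 / (1 + q ^ 2)))
      (2 / (p * (1 + p ^ 2)) * realPolylog k (p ^ 2 / (1 + p ^ 2))) p := by
  have hp : 1 + p ^ 2 ≠ 0 := by positivity
  have h : |p ^ 2 / (1 + p ^ 2)| < 1 := by
    rw [abs_of_pos (by positivity), div_lt_one (by positivity)]
    linarith
  refine ((hasDerivAt_realPolylog_succ k h (by positivity)).comp p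
    ((hasDerivAt_pow 2 p).div ((hasDerivAt_pow 2 p).const_add 1) hp)).congr_deriv ?_
  field_simp
  norm_num
  ring

lemma hasDerivAt_realPolylog_one_div (k : ℕ) {p : ℝ} (h₀ : 0 < p) :
    HasDerivAt (fun q : ℝ => realPolylog (k + 1) (1 / (1 + q ^ 2)))
      (-(2 * p / (1 + p ^ 2) * realPolylog k (1 / (1 + p ^ 2)))) p := by
  have hp : 1 + p ^ 2 ≠ 0 := by positivity
  have h : |1 / (1 + p ^ 2)| < 1 := by
    rw [abs_of_pos (by positivity), div_lt_one (by positivity)]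
    nlinarith
  refine ((hasDerivAt_realPolylog_succ k h (by positivity)).comp p
    ((hasDerivAt_const p 1).div ((hasDerivAt_pow 2 p).const_add 1) hp)).congr_deriv ?_
  field_simp
  norm_num
  ring

lemma continuousOn_realPolylog_neg_sq {k : ℕ} (hk : 2 ≤ k) :
    ContinuousOn (fun q : ℝ => realPolylog k (-q ^ 2)) (Set.Icc 0 1) :=
  (continuousOn_realPolylog hk).comp (by fun_prop) fun q hq =>
    ⟨by nlinarith [hq.1, hq.2], by nlinarith [hq.1, hq.2]⟩

lemma continuousOn_realPolylog_sq_div {k : ℕ} (hk : 2 ≤ k) (s : Set ℝ) :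
    ContinuousOn (fun q : ℝ => realPolylog k (q ^ 2 / (1 + q ^ 2))) s :=
  (continuousOn_realPolylog hk).comp (by fun_prop (disch := intros; positivity)) fun q _ =>
    ⟨by linarith [show 0 ≤ q ^ 2 / (1 + q ^ 2) by positivity],
      (div_le_one (by positivity)).2 (by linarith)⟩

lemma continuousOn_realPolylog_one_div {k : ℕ} (hk : 2 ≤ k) (s : Set ℝ) :
    ContinuousOn (fun q : ℝ => realPolylog k (1 / (1 + q ^ 2))) s :=
  (continuousOn_realPolylog hk).comp (by fun_prop (disch := intros; positivity)) fun q _ =>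
    ⟨by linarith [show 0 ≤ 1 / (1 + q ^ 2) by positivity],
      (div_le_one (by positivity)).2 (by nlinarith)⟩

lemma continuous_log_one_add_sq : Continuous fun q : ℝ => Real.log (1 + q ^ 2) :=
  continuous_iff_continuousAt.2 fun p => (hasDerivAt_log_one_add_sq p).continuousAt

lemma continuous_sq_log_one_add_sq_mul_log :
    Continuous fun q : ℝ => Real.log (1 + q ^ 2) ^ 2 * Real.log q := by
  refine continuous_iff_continuousAt.2 fun p => ?_
  rcases eq_or_ne p 0 with rfl | hp
  · have hlim : Filter.Tendsto (fun q : ℝ => |q ^ 3 * (q * Real.log q)|) (nhds 0) (nhds 0) := by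
      have : Continuous fun q : ℝ => |q ^ 3 * (q * Real.log q)| :=
        ((continuous_id.pow 3).mul Real.continuous_mul_log).abs
      simpa using this.tendsto 0
    have h := squeeze_zero_norm (f := fun q : ℝ => Real.log (1 + q ^ 2) ^ 2 * Real.log q)
      (fun q => ?_) hlim
    · simpa [ContinuousAt] using h
    · have h₀ : 0 ≤ Real.log (1 + q ^ 2) := Real.log_nonneg (by nlinarith)
      have h₁ : Real.log (1 + q ^ 2) ≤ q ^ 2 := by
        linarith [Real.log_le_sub_one_of_pos (show 0 < 1 + q ^ 2 by positivity)]
      have h₂ : Real.log (1 + q ^ 2) ^ 2 ≤ |q| ^ 4 := by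
        rw [show |q| ^ 4 = (q ^ 2) ^ 2 by rw [← sq_abs q]; ring]
        gcongr
      rw [Real.norm_eq_abs, abs_mul, abs_mul, abs_mul, abs_pow, abs_pow, abs_of_nonneg h₀]
      nlinarith [abs_nonneg (Real.log q)]
  · exact (continuous_log_one_add_sq.continuousAt.pow 2).mul (Real.continuousAt_log hp)

lemma integralBetaSq_eq {p : ℝ} (h₀ : 0 < p) (h₁ : p ≤ 1) :
    integralBetaSq p = -(Real.pi / 4) * realPolylog 2 (-p ^ 2) := by
  refine eq_of_hasDerivAt_eq (f := integralBetaSq)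
    (g := fun p => -(Real.pi / 4) * realPolylog 2 (-p ^ 2)) h₀
    continuous_integralBetaSq.continuousOn
    (((continuousOn_realPolylog_neg_sq le_rfl).mono (Set.Icc_subset_Icc_right h₁)).const_mul _)
    (fun x hx => hasDerivAt_integralBetaSq hx.1.ne')
    (fun x hx => ((hasDerivAt_realPolylog_neg_sq 1 hx.1 (hx.2.trans_le h₁)).const_mul
      _).congr_deriv ?_) (by simp [integralBetaSq])
  have h : |-x ^ 2| < 1 := by
    rw [abs_neg, abs_of_pos (pow_pos hx.1 2)]
    nlinarith [hx.1, hx.2]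
  rw [realPolylog_one_left h, integralBeta_eq hx.1, sub_neg_eq_add]
  ring

lemma integralThetaSq_eq_realPolylog {p : ℝ} (h₀ : 0 < p) :
    integralThetaSq p = Real.pi / 4 * realPolylog 2 (p ^ 2 / (1 + p ^ 2)) := by
  refine eq_of_hasDerivAt_eq (f := integralThetaSq)
    (g := fun p => Real.pi / 4 * realPolylog 2 (p ^ 2 / (1 + p ^ 2))) h₀
    continuous_integralThetaSq.continuousOn
    ((continuousOn_realPolylog_sq_div le_rfl _).const_mul _)
    (fun x hx => hasDerivAt_integralThetaSq hx.1.ne')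
    (fun x hx => ((hasDerivAt_realPolylog_sq_div 1 hx.1).const_mul _).congr_deriv ?_)
    (by simp [integralThetaSq])
  have hpos : 0 < 1 + x ^ 2 := by positivity
  have hx0 := hx.1
  have h : |x ^ 2 / (1 + x ^ 2)| < 1 := by
    rw [abs_of_pos (by positivity), div_lt_one (by positivity)]
    linarith
  rw [realPolylog_one_left h, integralBeta_eq hx.1,
    show 1 - x ^ 2 / (1 + x ^ 2) = (1 + x ^ 2)⁻¹ by field_simp; ring, Real.log_inv]
  ring

lemma integralThetaSq_eq {p : ℝ} (h₀ : 0 < p) :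
    integralThetaSq p = integralBetaSq p - Real.pi / 8 * Real.log (1 + p ^ 2) ^ 2 := by
  have hL := continuous_log_one_add_sq
  refine eq_of_hasDerivAt_eq (f := integralThetaSq)
    (g := fun p => integralBetaSq p - Real.pi / 8 * Real.log (1 + p ^ 2) ^ 2) h₀
    continuous_integralThetaSq.continuousOn
    (continuous_integralBetaSq.sub (continuous_const.mul (hL.pow 2))).continuousOn
    (fun x hx => hasDerivAt_integralThetaSq hx.1.ne')
    (fun x hx => ((hasDerivAt_integralBetaSq hx.1.ne').sub
      (((hasDerivAt_log_one_add_sq x).fun_pow 2).const_mul _)).congr_deriv ?_)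
    (by simp [integralThetaSq, integralBetaSq])
  have hx0 := hx.1.ne'
  have hpos : 1 + x ^ 2 ≠ 0 := by positivity
  rw [integralBeta_eq hx.1]
  field_simp
  norm_num
  ring

lemma integralBetaThetaSq_eq {p : ℝ} (h₀ : 0 < p) :
    integralBetaThetaSq p =
      integralBetaCube p / 3 - Real.pi / 48 * Real.log (1 + p ^ 2) ^ 3 := by
  have hL := continuous_log_one_add_sq
  refine eq_of_hasDerivAt_eq (f := integralBetaThetaSq)
    (g := fun p => integralBetaCube p / 3 - Real.pi / 48 * Real.log (1 + p ^ 2) ^ 3) h₀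
    continuous_integralBetaThetaSq.continuousOn
    ((continuous_integralBetaCube.div_const _).sub
      (continuous_const.mul (hL.pow 3))).continuousOn
    (fun x hx => hasDerivAt_integralBetaThetaSq x)
    (fun x hx => (((hasDerivAt_integralBetaCube x).div_const 3).sub
      (((hasDerivAt_log_one_add_sq x).fun_pow 3).const_mul _)).congr_deriv ?_)
    (by simp [integralBetaThetaSq, integralBetaCube])
  rw [integralThetaSq_eq hx.1]
  norm_num
  ring

lemma integralBetaPrimitive_eq {p : ℝ} (h₀ : 0 < p) (h₁ : p ≤ 1) :
    integralBetaPrimitive p = -(Real.pi / 4) * realPolylog 3 (-p ^ 2)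
      - Real.log (1 + p ^ 2) * integralBetaSq p / 4 - integralBetaCube p / 6 := by
  have hL := continuous_log_one_add_sq
  refine eq_of_hasDerivAt_eq (f := integralBetaPrimitive)
    (g := fun p => -(Real.pi / 4) * realPolylog 3 (-p ^ 2)
      - Real.log (1 + p ^ 2) * integralBetaSq p / 4 - integralBetaCube p / 6) h₀
    continuous_integralBetaPrimitive.continuousOn
    (((((continuousOn_realPolylog_neg_sq (by norm_num)).mono
      (Set.Icc_subset_Icc_right h₁)).const_mul _).sub
      ((hL.mul continuous_integralBetaSq).div_const _).continuousOn).sub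
      (continuous_integralBetaCube.div_const _).continuousOn)
    (fun x hx => hasDerivAt_integralBetaPrimitive hx.1.ne')
    (fun x hx => ((((hasDerivAt_realPolylog_neg_sq 2 hx.1 (hx.2.trans_le h₁)).const_mul _).sub
      (((hasDerivAt_log_one_add_sq x).fun_mul (hasDerivAt_integralBetaSq hx.1.ne')).div_const
        4)).sub ((hasDerivAt_integralBetaCube x).div_const 6)).congr_deriv ?_)
    (by simp [integralBetaPrimitive, integralBetaCube])
  have hx0 := hx.1.ne'
  have hpos : 1 + x ^ 2 ≠ 0 := by positivity
  have hQ := integralBetaSq_eq hx.1 (hx.2.le.trans h₁)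
  rw [integralThetaSq_eq hx.1, integralBeta_eq hx.1]
  field_simp
  linear_combination (-1536 * (1 + x ^ 2)) * hQ

lemma realPolylog_three_one_half : realPolylog 3 (1 / 2) = -realPolylog 3 (-1)
    - 2 / Real.pi * integralBetaSq 1 * Real.log 2 - 4 / (3 * Real.pi) * integralBetaCube 1
    + Real.log 2 ^ 3 / 6 := by
  have hL := continuous_log_one_add_sq
  have hπ := Real.pi_ne_zero
  have h := eq_of_hasDerivAt_eq (f := fun p => realPolylog 3 (p ^ 2 / (1 + p ^ 2)))
    (g := fun p => -realPolylog 3 (-p ^ 2)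
      - 2 / Real.pi * (integralBetaSq p * Real.log (1 + p ^ 2))
      - 4 / (3 * Real.pi) * integralBetaCube p + Real.log (1 + p ^ 2) ^ 3 / 6) one_pos
    (continuousOn_realPolylog_sq_div (by norm_num) _)
    ((((continuousOn_realPolylog_neg_sq (by norm_num)).neg.sub
      ((continuous_integralBetaSq.mul hL).const_mul _).continuousOn).sub
      (continuous_integralBetaCube.const_mul _).continuousOn).add
      ((hL.pow 3).div_const _).continuousOn)
    (fun x hx => hasDerivAt_realPolylog_sq_div 2 hx.1)
    (fun x hx => (((((hasDerivAt_realPolylog_neg_sq 2 hx.1 hx.2).neg).sub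
      (((hasDerivAt_integralBetaSq hx.1.ne').fun_mul
        (hasDerivAt_log_one_add_sq x)).const_mul _)).sub
      ((hasDerivAt_integralBetaCube x).const_mul _)).add
      (((hasDerivAt_log_one_add_sq x).fun_pow 3).div_const 6)).congr_deriv ?_)
    (by simp [integralBetaCube])
  · norm_num at h ⊢
    linear_combination h
  have hx0 := hx.1.ne'
  have hpos : 1 + x ^ 2 ≠ 0 := by positivity
  have hQ := integralBetaSq_eq hx.1 hx.2.le
  have hT := integralThetaSq_eq_realPolylog hx.1
  rw [integralThetaSq_eq hx.1] at hT
  have hQ' : realPolylog 2 (-x ^ 2) = -(4 / Real.pi * integralBetaSq x) := by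
    rw [hQ]; field_simp
  have hT' : realPolylog 2 (x ^ 2 / (1 + x ^ 2)) = 4 / Real.pi * integralBetaSq x
      - Real.log (1 + x ^ 2) ^ 2 / 2 := by
    field_simp at hT ⊢
    linear_combination (-1 / 4) * hT
  rw [integralBeta_eq hx.1, hQ', hT']
  field_simp
  norm_num
  ring

lemma log_two_mul_integralBetaSq_sub :
    4 / Real.pi * (Real.log 2 * integralBetaSq 1) - 8 / (3 * Real.pi) * integralBetaCube 1 =
      -(2 / 3) * Real.log 2 ^ 3 - 2 * (Real.log 2 * realPolylog 2 (1 / 2))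
      - 2 * realPolylog 3 (1 / 2) + 2 * realPolylog 3 1 := by
  have hL := continuous_log_one_add_sq
  have hπ := Real.pi_ne_zero
  have h := eq_of_hasDerivAt_eq (f := fun p => 4 / Real.pi * (Real.log (1 + p ^ 2) *
      integralBetaSq p) - 8 / (3 * Real.pi) * integralBetaCube p)
    (g := fun p => 2 * (Real.log (1 + p ^ 2) ^ 2 * Real.log p)
      - 2 / 3 * Real.log (1 + p ^ 2) ^ 3
      - 2 * (Real.log (1 + p ^ 2) * realPolylog 2 (1 / (1 + p ^ 2)))
      - 2 * realPolylog 3 (1 / (1 + p ^ 2)) + 2 * realPolylog 3 1)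
    (f' := fun p => 2 * Real.log (1 + p ^ 2) ^ 2 / p) one_pos
    (((hL.mul continuous_integralBetaSq).const_mul _).sub
      (continuous_integralBetaCube.const_mul _)).continuousOn
    ((((((continuous_sq_log_one_add_sq_mul_log.const_mul _).sub
      ((hL.pow 3).const_mul _)).continuousOn).sub
      ((hL.continuousOn.mul (continuousOn_realPolylog_one_div le_rfl _)).const_mul _)).sub
      ((continuousOn_realPolylog_one_div (by norm_num) _).const_mul _)).add continuousOn_const)
    (fun x hx => ((((hasDerivAt_log_one_add_sq x).fun_mul
      (hasDerivAt_integralBetaSq hx.1.ne')).const_mul _).sub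
      ((hasDerivAt_integralBetaCube x).const_mul _)).congr_deriv ?_)
    (fun x hx => ((((((((hasDerivAt_log_one_add_sq x).fun_pow 2).fun_mul
      (Real.hasDerivAt_log hx.1.ne')).const_mul 2).sub
      (((hasDerivAt_log_one_add_sq x).fun_pow 3).const_mul (2 / 3))).sub
      (((hasDerivAt_log_one_add_sq x).fun_mul
        (hasDerivAt_realPolylog_one_div 1 hx.1)).const_mul 2)).sub
      ((hasDerivAt_realPolylog_one_div 2 hx.1).const_mul 2)).add_const _).congr_deriv ?_)
    (by simp [integralBetaCube])
  · norm_num at h ⊢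
    linear_combination h
  · have hx0 := hx.1.ne'
    have hpos : 1 + x ^ 2 ≠ 0 := by positivity
    rw [integralBeta_eq hx.1]
    field_simp
    ring
  · have hx0 := hx.1
    have hpos : 1 + x ^ 2 ≠ 0 := by positivity
    have h : |1 / (1 + x ^ 2)| < 1 := by
      rw [abs_of_pos (by positivity), div_lt_one (by positivity)]
      nlinarith
    have hr : Real.log (1 - 1 / (1 + x ^ 2)) = 2 * Real.log x - Real.log (1 + x ^ 2) := by
      rw [show 1 - 1 / (1 + x ^ 2) = x ^ 2 / (1 + x ^ 2) by field_simp; ring,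
        Real.log_div (by positivity) hpos, Real.log_pow]
      norm_num
    rw [realPolylog_one_left h, hr]
    field_simp
    norm_num
    ring

lemma integralBeta_one : integralBeta 1 = Real.pi / 4 * Real.log 2 := by
  rw [integralBeta_eq one_pos]
  norm_num

lemma integralBetaSq_one : integralBetaSq 1 = Real.pi ^ 3 / 48 := by
  rw [integralBetaSq_eq one_pos le_rfl, one_pow, realPolylog_two_neg_one]
  ring

lemma integralThetaSq_one :
    integralThetaSq 1 = Real.pi ^ 3 / 48 - Real.pi / 8 * Real.log 2 ^ 2 := by
  rw [integralThetaSq_eq one_pos, integralBetaSq_one]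
  norm_num

lemma integralBetaCube_one : integralBetaCube 1 =
    Real.pi ^ 3 / 32 * Real.log 2 - 3 * Real.pi / 32 * realPolylog 3 1 := by
  have hπ := Real.pi_ne_zero
  have h₁ := log_two_mul_integralBetaSq_sub
  have h₂ : realPolylog 2 (1 / 2) = 4 / Real.pi * integralThetaSq 1 := by
    rw [integralThetaSq_eq_realPolylog one_pos]
    field_simp
    norm_num
  rw [realPolylog_three_one_half, h₂, integralThetaSq_one, integralBetaSq_one,
    realPolylog_three_neg_one] at h₁
  field_simp at h₁ ⊢
  linear_combination (-1 / 4608) * h₁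

lemma integralBetaThetaSq_one : integralBetaThetaSq 1 = Real.pi ^ 3 / 96 * Real.log 2
    - Real.pi / 32 * realPolylog 3 1 - Real.pi / 48 * Real.log 2 ^ 3 := by
  rw [integralBetaThetaSq_eq one_pos, integralBetaCube_one]
  norm_num
  ring

lemma integralBetaPrimitive_one : integralBetaPrimitive 1 =
    13 * Real.pi / 64 * realPolylog 3 1 - Real.pi ^ 3 / 96 * Real.log 2 := by
  rw [integralBetaPrimitive_eq one_pos le_rfl, integralBetaSq_one, integralBetaCube_one, one_pow,
    realPolylog_three_neg_one]
  norm_num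
  ring

end Evaluation

section IteratedIntegrals

/-- Iterated integrals of real functions from `0` to `s`, the head of the list being outermost. -/
noncomputable def realIterInt : List (ℝ → ℝ) → ℝ → ℝ
  | [], _ => 1
  | f :: l, s => ∫ t in (0 : ℝ)..s, realIterInt l t * f t

lemma continuous_realIterInt : ∀ {l : List (ℝ → ℝ)}, (∀ f ∈ l, Continuous f) →
    Continuous (realIterInt l)
  | [], _ => continuous_const
  | f :: l, h => by
    have hl := continuous_realIterInt fun g hg => h g (List.mem_cons_of_mem f hg)
    exact intervalIntegral.continuous_primitive
      (fun a b => (hl.mul (h f List.mem_cons_self)).intervalIntegrable a b) 0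

lemma hasDerivAt_realIterInt_cons {f : ℝ → ℝ} {l : List (ℝ → ℝ)}
    (h : ∀ g ∈ f :: l, Continuous g) (s : ℝ) :
    HasDerivAt (realIterInt (f :: l)) (realIterInt l s * f s) s :=
  ((continuous_realIterInt fun g hg => h g (List.mem_cons_of_mem f hg)).mul
    (h f List.mem_cons_self)).integral_hasStrictDerivAt 0 s |>.hasDerivAt

lemma realIterInt_eq_of_hasDerivAt {f : ℝ → ℝ} {l : List (ℝ → ℝ)} (h : ∀ g ∈ f :: l, Continuous g)
    {G : ℝ → ℝ} (hG : ∀ t, HasDerivAt G (realIterInt l t * f t) t) (h₀ : G 0 = 0) :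
    realIterInt (f :: l) = G := by
  ext s
  have hc := (continuous_realIterInt fun g hg => h g (List.mem_cons_of_mem f hg)).mul
    (h f List.mem_cons_self)
  rw [realIterInt, integral_eq_sub_of_hasDerivAt_of_continuous hG hc, h₀, sub_zero]

lemma integral_realIterInt_cons_mul {f k h : ℝ → ℝ} {l : List (ℝ → ℝ)} {b : ℝ}
    (hl : ∀ g ∈ f :: l, Continuous g) (hh : Continuous h)
    (hk : ∀ x, HasDerivAt k (-h x) x) (hb : k b = 0) :
    ∫ x in (0 : ℝ)..b, realIterInt (f :: l) x * h x
      = ∫ x in (0 : ℝ)..b, realIterInt l x * (f x * k x) := by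
  have hkc : Continuous k := continuous_iff_continuousAt.2 fun x => (hk x).continuousAt
  have hfc := hl f List.mem_cons_self
  have h₁ := continuous_realIterInt hl
  have h₂ := continuous_realIterInt fun g hg => hl g (List.mem_cons_of_mem f hg)
  rw [eq_comm, ← sub_eq_zero,
    ← intervalIntegral.integral_sub (by apply Continuous.intervalIntegrable; fun_prop)
      (by apply Continuous.intervalIntegrable; fun_prop),
    integral_eq_sub_of_hasDerivAt_of_continuous (G := fun x => realIterInt (f :: l) x * k x) _
      (by fun_prop)]
  · simp [hb, realIterInt]
  · intro x
    refine ((hasDerivAt_realIterInt_cons hl x).mul (hk x)).congr_deriv ?_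
    ring

lemma iterIntAux_comp_mul_deriv {φ φ' : ℝ → ℝ} (hφ : ∀ t, HasDerivAt φ (φ' t) t)
    (hφ' : Continuous φ') (h₀ : φ 0 = 0) :
    ∀ {l : List (ℂ × (ℝ → ℝ))}, (∀ x ∈ l, Continuous x.2) → ∀ t : ℝ,
      iterIntAux (l.map fun x t => x.1 * ((x.2 (φ t) * φ' t : ℝ) : ℂ)) t
        = (l.map Prod.fst).prod * (realIterInt (l.map Prod.snd) (φ t) : ℂ)
  | [], _, t => by simp [iterIntAux, realIterInt]
  | (c, f) :: l, h, t => by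
    have hl : ∀ x ∈ l, Continuous x.2 := fun x hx => h x (List.mem_cons_of_mem _ hx)
    have hf : Continuous f := h (c, f) List.mem_cons_self
    have hc : Continuous (realIterInt (l.map Prod.snd)) :=
      continuous_realIterInt fun g hg => by
        obtain ⟨x, hx, rfl⟩ := List.mem_map.1 hg
        exact hl x hx
    have key := intervalIntegral.integral_comp_mul_deriv (a := 0) (b := t) (fun x _ => hφ x)
      hφ'.continuousOn (hc.mul hf)
    simp only [List.map_cons, iterIntAux, realIterInt, List.prod_cons,
      iterIntAux_comp_mul_deriv hφ hφ' h₀ hl]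
    simp only [h₀, Function.comp_apply, Pi.mul_apply] at key
    rw [← key, ← intervalIntegral.integral_ofReal, ← intervalIntegral.integral_const_mul]
    congr 1
    ext x
    push_cast
    ring

/-- The change of variables under which the third form becomes constant. -/
noncomputable def lawsonAngle (t : ℝ) : ℝ :=
  Real.arctan (√2 * t + 1) + Real.arctan (√2 * t - 1)

lemma lawsonAngle_zero : lawsonAngle 0 = 0 := by
  simp [lawsonAngle, Real.arctan_neg]

lemma lawsonAngle_one : lawsonAngle 1 = Real.pi / 2 := by
  have h2 : √2 ^ 2 = 2 := Real.sq_sqrt (by norm_num)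
  have h : √2 - 1 = (√2 + 1)⁻¹ := by
    field_simp
    linear_combination h2
  rw [lawsonAngle, mul_one, h, Real.arctan_inv_of_pos (by positivity)]
  ring

lemma one_add_sq_mul_one_add_sq_eq (t : ℝ) :
    (1 + (√2 * t + 1) ^ 2) * (1 + (√2 * t - 1) ^ 2) = 2 ^ 2 * (t ^ 4 + 1) := by
  have h2 : √2 ^ 2 = 2 := Real.sq_sqrt (by norm_num)
  linear_combination (t ^ 4 * (√2 ^ 2 + 2)) * h2

lemma hasDerivAt_lawsonAngle (t : ℝ) :
    HasDerivAt lawsonAngle (√2 * (t ^ 2 + 1) / (t ^ 4 + 1)) t := by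
  have h2 : √2 ^ 2 = 2 := Real.sq_sqrt (by norm_num)
  have ht : t ^ 4 + 1 ≠ 0 := by positivity
  have hprod := one_add_sq_mul_one_add_sq_eq t
  have h₁ : 1 + (√2 * t + 1) ^ 2 ≠ 0 := by positivity
  have h₂ : 1 + (√2 * t - 1) ^ 2 ≠ 0 := by positivity
  have hlin : HasDerivAt (fun t => √2 * t) √2 t := by simpa using (hasDerivAt_id t).const_mul √2
  refine ((hlin.add_const 1).arctan.add (hlin.sub_const 1).arctan).congr_deriv ?_
  have hsum : √2 * (1 / (1 + (√2 * t + 1) ^ 2) + 1 / (1 + (√2 * t - 1) ^ 2))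
      = √2 * (t ^ 2 + 1) * 4 / ((1 + (√2 * t + 1) ^ 2) * (1 + (√2 * t - 1) ^ 2)) := by
    field_simp
    linear_combination (2 * t ^ 2) * h2
  calc _ = √2 * (1 / (1 + (√2 * t + 1) ^ 2) + 1 / (1 + (√2 * t - 1) ^ 2)) := by ring
    _ = _ := by
      rw [hsum, hprod]
      field_simp
      norm_num

lemma sqrt_one_add_sq_mul_sqrt_one_add_sq (t : ℝ) :
    √(1 + (√2 * t + 1) ^ 2) * √(1 + (√2 * t - 1) ^ 2) = 2 * √(t ^ 4 + 1) := by
  rw [← Real.sqrt_mul (by positivity), one_add_sq_mul_one_add_sq_eq,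
    Real.sqrt_mul (by positivity), Real.sqrt_sq (by norm_num)]

lemma sin_lawsonAngle (t : ℝ) : Real.sin (lawsonAngle t) = √2 * t / √(t ^ 4 + 1) := by
  have h := sqrt_one_add_sq_mul_sqrt_one_add_sq t
  have h₁ : √(1 + (√2 * t + 1) ^ 2) ≠ 0 := by positivity
  have h₂ : √(1 + (√2 * t - 1) ^ 2) ≠ 0 := by positivity
  have h₃ : √(t ^ 4 + 1) ≠ 0 := by positivity
  rw [lawsonAngle, Real.sin_add, Real.sin_arctan, Real.sin_arctan, Real.cos_arctan,
    Real.cos_arctan, div_mul_div_comm, div_mul_div_comm, h]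
  field_simp
  ring

lemma cos_lawsonAngle (t : ℝ) : Real.cos (lawsonAngle t) = (1 - t ^ 2) / √(t ^ 4 + 1) := by
  have h2 : √2 ^ 2 = 2 := Real.sq_sqrt (by norm_num)
  have h := sqrt_one_add_sq_mul_sqrt_one_add_sq t
  have h₃ : √(t ^ 4 + 1) ≠ 0 := by positivity
  rw [lawsonAngle, Real.cos_add, Real.sin_arctan, Real.sin_arctan, Real.cos_arctan,
    Real.cos_arctan, div_mul_div_comm, div_mul_div_comm, h]
  field_simp
  linear_combination (-t ^ 2) * h2

lemma lawsonRoot_lawsonAngle (t : ℝ) :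
    lawsonRoot 1 (lawsonAngle t) = (t ^ 2 + 1) / √(t ^ 4 + 1) := by
  have h2 : √2 ^ 2 = 2 := Real.sq_sqrt (by norm_num)
  have h4 : √(t ^ 4 + 1) ^ 2 = t ^ 4 + 1 := Real.sq_sqrt (by positivity)
  have ht : t ^ 4 + 1 ≠ 0 := by positivity
  rw [lawsonRoot, Real.sqrt_eq_iff_mul_self_eq_of_pos (by positivity), sin_lawsonAngle, ← sq,
    div_pow, div_pow, h4]
  field_simp
  linear_combination (-t ^ 2) * h2

/-- The function `u = sin γ / √(1 + sin² γ)`, the first form in the coordinate `γ` up to a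
constant factor. It is minus the derivative of `θ` at `p = 1`. -/
noncomputable def lawsonU (γ : ℝ) : ℝ := Real.sin γ / lawsonRoot 1 γ

/-- The function `v = cos γ / √(1 + sin² γ)`, the second form in the coordinate `γ` up to a
constant factor. It is the derivative of `β` at `p = 1`. -/
noncomputable def lawsonV (γ : ℝ) : ℝ := Real.cos γ / lawsonRoot 1 γ

@[simp, fun_prop]
lemma continuous_lawsonU : Continuous lawsonU :=
  Real.continuous_sin.div_lawsonRoot continuous_const continuous_id

@[simp, fun_prop]
lemma continuous_lawsonV : Continuous lawsonV :=
  Real.continuous_cos.div_lawsonRoot continuous_const continuous_id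

lemma hasDerivAt_lawsonBeta_one (γ : ℝ) : HasDerivAt (lawsonBeta 1) (lawsonV γ) γ := by
  simpa [lawsonV] using hasDerivAt_lawsonBeta 1 γ

lemma hasDerivAt_lawsonTheta_one (γ : ℝ) : HasDerivAt (lawsonTheta 1) (-lawsonU γ) γ := by
  simpa [lawsonU] using hasDerivAt_lawsonTheta 1 γ

/-- The form `c f(γ) dγ` in the coordinate `t`, where `γ = lawsonAngle t`. -/
noncomputable def lawsonPullback (x : ℂ × (ℝ → ℝ)) (t : ℝ) : ℂ :=
  x.1 * ((x.2 (lawsonAngle t) * (√2 * (t ^ 2 + 1) / (t ^ 4 + 1)) : ℝ) : ℂ)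

lemma lawsonOmegaForm1_eq : lawsonOmegaForm1 = lawsonPullback (2 * Complex.I, lawsonU) := by
  ext t
  have h2 : √2 ^ 2 = 2 := Real.sq_sqrt (by norm_num)
  have ht : t ^ 4 + 1 ≠ 0 := by positivity
  have h : lawsonU (lawsonAngle t) * (√2 * (t ^ 2 + 1) / (t ^ 4 + 1)) = 2 * t / (t ^ 4 + 1) := by
    rw [lawsonU, sin_lawsonAngle, lawsonRoot_lawsonAngle]
    field_simp
    linear_combination t * h2
  simp only [lawsonOmegaForm1, lawsonPullback]
  rw [h]
  push_cast
  ring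

lemma lawsonOmegaForm2_eq : lawsonOmegaForm2 = lawsonPullback (-2, lawsonV) := by
  ext t
  have ht : t ^ 4 + 1 ≠ 0 := by positivity
  have h : lawsonV (lawsonAngle t) * (√2 * (t ^ 2 + 1) / (t ^ 4 + 1))
      = √2 * (1 - t ^ 2) / (t ^ 4 + 1) := by
    rw [lawsonV, cos_lawsonAngle, lawsonRoot_lawsonAngle]
    field_simp
  simp only [lawsonOmegaForm2, lawsonPullback]
  rw [h]
  push_cast
  ring

lemma lawsonOmegaForm3_eq : lawsonOmegaForm3 = lawsonPullback (2 * Complex.I, fun _ => 1) := by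
  ext t
  simp only [lawsonOmegaForm3, lawsonPullback]
  push_cast
  ring

lemma OmegaValue_map_lawsonPullback {l : List (ℂ × (ℝ → ℝ))} (h : ∀ x ∈ l, Continuous x.2) :
    OmegaValue (l.map lawsonPullback) =
      (l.map Prod.fst).prod * (realIterInt (l.map Prod.snd).reverse (Real.pi / 2) : ℂ) := by
  have key := iterIntAux_comp_mul_deriv hasDerivAt_lawsonAngle
    (by fun_prop (disch := intro; positivity)) lawsonAngle_zero (l := l.reverse)
    (fun x hx => h x (List.mem_reverse.1 hx)) 1
  rw [lawsonAngle_one, List.map_reverse, List.map_reverse, List.map_reverse,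
    List.prod_reverse] at key
  exact key

end IteratedIntegrals

section Words

lemma realIterInt_v : realIterInt [lawsonV] = lawsonBeta 1 :=
  realIterInt_eq_of_hasDerivAt (by simp)
    (fun t => (hasDerivAt_lawsonBeta_one t).congr_deriv (by simp [realIterInt])) (by simp)

lemma realIterInt_vv : realIterInt [lawsonV, lawsonV] = fun t => lawsonBeta 1 t ^ 2 / 2 :=
  realIterInt_eq_of_hasDerivAt (by simp)
    (fun t => (((hasDerivAt_lawsonBeta_one t).fun_pow 2).div_const 2).congr_deriv
      (by rw [realIterInt_v]; norm_num; ring)) (by simp)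

lemma realIterInt_vvv :
    realIterInt [lawsonV, lawsonV, lawsonV] = fun t => lawsonBeta 1 t ^ 3 / 6 :=
  realIterInt_eq_of_hasDerivAt (by simp)
    (fun t => (((hasDerivAt_lawsonBeta_one t).fun_pow 3).div_const 6).congr_deriv
      (by rw [realIterInt_vv]; norm_num; ring)) (by simp)

lemma realIterInt_one : realIterInt [fun _ => 1] = fun t => t := by
  ext t
  simp [realIterInt]

lemma realIterInt_one_one : realIterInt [fun _ => 1, fun _ => 1] = fun t => t ^ 2 / 2 := by
  ext t
  rw [realIterInt, realIterInt_one]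
  simp

lemma realIterInt_one_one_one (t : ℝ) :
    realIterInt [fun _ => 1, fun _ => 1, fun _ => 1] t = t ^ 3 / 6 := by
  rw [realIterInt, realIterInt_one_one]
  simp
  ring

lemma realIterInt_u_one :
    realIterInt [lawsonU, fun _ => 1] = fun t => primitiveTheta 1 t - t * lawsonTheta 1 t :=
  realIterInt_eq_of_hasDerivAt (by simp [continuous_const])
    (fun t => ((hasDerivAt_primitiveTheta 1 t).sub
      ((hasDerivAt_id t).mul (hasDerivAt_lawsonTheta_one t))).congr_deriv
      (by rw [realIterInt_one]; simp)) (by simp)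

lemma realIterInt_u_v : realIterInt [lawsonU, lawsonV] (Real.pi / 2) = integralBeta 1 := by
  rw [realIterInt, realIterInt_v, integralBeta]
  simp [lawsonU]

lemma realIterInt_one_v_v :
    realIterInt [fun _ => 1, lawsonV, lawsonV] (Real.pi / 2) = integralBetaSq 1 / 2 := by
  rw [realIterInt, realIterInt_vv, integralBetaSq, ← intervalIntegral.integral_div]
  simp

lemma realIterInt_u_v_v_v :
    realIterInt [lawsonU, lawsonV, lawsonV, lawsonV] (Real.pi / 2) = integralBetaCube 1 / 6 := by
  rw [realIterInt, realIterInt_vvv, integralBetaCube, ← intervalIntegral.integral_div]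
  congr 1
  ext t
  simp [lawsonU]
  ring

lemma hasDerivAt_sq_lawsonTheta_one_div_two (γ : ℝ) :
    HasDerivAt (fun x => lawsonTheta 1 x ^ 2 / 2) (-(lawsonU γ * lawsonTheta 1 γ)) γ :=
  (((hasDerivAt_lawsonTheta_one γ).fun_pow 2).div_const 2).congr_deriv (by norm_num; ring)

lemma hasDerivAt_pi_div_two_sub (x : ℝ) : HasDerivAt (fun x => Real.pi / 2 - x) (-1) x :=
  (hasDerivAt_id x).const_sub _

lemma hasDerivAt_sq_pi_div_two_sub_div_two (x : ℝ) :
    HasDerivAt (fun x => (Real.pi / 2 - x) ^ 2 / 2) (-(1 * (Real.pi / 2 - x))) x :=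
  (((hasDerivAt_pi_div_two_sub x).fun_pow 2).div_const 2).congr_deriv (by norm_num; ring)

lemma realIterInt_u_u_cons {f : ℝ → ℝ} {l : List (ℝ → ℝ)} (h : ∀ g ∈ f :: l, Continuous g) :
    realIterInt (lawsonU :: lawsonU :: f :: l) (Real.pi / 2) =
      ∫ x in (0 : ℝ)..(Real.pi / 2), realIterInt l x * (f x * (lawsonTheta 1 x ^ 2 / 2)) := by
  have h' : ∀ g ∈ lawsonU :: f :: l, Continuous g :=
    List.forall_mem_cons.2 ⟨continuous_lawsonU, h⟩
  rw [realIterInt, integral_realIterInt_cons_mul h' continuous_lawsonU hasDerivAt_lawsonTheta_one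
    (by simp), integral_realIterInt_cons_mul h (by fun_prop)
    hasDerivAt_sq_lawsonTheta_one_div_two (by simp)]

lemma realIterInt_u_u_one :
    realIterInt [lawsonU, lawsonU, fun _ => 1] (Real.pi / 2) = integralThetaSq 1 / 2 := by
  rw [realIterInt_u_u_cons (by simp [continuous_const]), integralThetaSq,
    ← intervalIntegral.integral_div]
  simp [realIterInt]

lemma realIterInt_u_u_u_v :
    realIterInt [lawsonU, lawsonU, lawsonU, lawsonV] (Real.pi / 2)
      = integralBetaThetaSq 1 / 2 := by
  rw [realIterInt_u_u_cons (by simp), realIterInt_v, integralBetaThetaSq,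
    ← intervalIntegral.integral_div]
  congr 1
  ext t
  simp only [lawsonU]
  ring

lemma realIterInt_one_one_u_v :
    realIterInt [fun _ => 1, fun _ => 1, lawsonU, lawsonV] (Real.pi / 2) =
      ∫ x in (0 : ℝ)..(Real.pi / 2),
        lawsonBeta 1 x * (lawsonU x * ((Real.pi / 2 - x) ^ 2 / 2)) := by
  rw [realIterInt, integral_realIterInt_cons_mul (by simp [continuous_const]) continuous_const
    hasDerivAt_pi_div_two_sub (by simp), integral_realIterInt_cons_mul (by simp)
    (by fun_prop) hasDerivAt_sq_pi_div_two_sub_div_two (by simp), realIterInt_v]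

lemma realIterInt_u_v_one_one :
    realIterInt [lawsonU, lawsonV, fun _ => 1, fun _ => 1] (Real.pi / 2) =
      ∫ x in (0 : ℝ)..(Real.pi / 2), x ^ 2 / 2 * (lawsonV x * lawsonTheta 1 x) := by
  rw [realIterInt, integral_realIterInt_cons_mul (by simp [continuous_const]) continuous_lawsonU
    hasDerivAt_lawsonTheta_one (by simp), realIterInt_one_one]

lemma realIterInt_one_v_u_one :
    realIterInt [fun _ => 1, lawsonV, lawsonU, fun _ => 1] (Real.pi / 2) =
      ∫ x in (0 : ℝ)..(Real.pi / 2),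
        (primitiveTheta 1 x - x * lawsonTheta 1 x) * (lawsonV x * (Real.pi / 2 - x)) := by
  rw [realIterInt, integral_realIterInt_cons_mul (by simp [continuous_const]) continuous_const
    hasDerivAt_pi_div_two_sub (by simp), realIterInt_u_one]

lemma realIterInt_combination :
    -realIterInt [fun _ => 1, lawsonV, lawsonU, fun _ => 1] (Real.pi / 2)
      + realIterInt [fun _ => 1, fun _ => 1, lawsonU, lawsonV] (Real.pi / 2)
      + realIterInt [lawsonU, lawsonV, fun _ => 1, fun _ => 1] (Real.pi / 2)
      = Real.pi ^ 2 / 8 * integralBeta 1 - integralBetaPrimitive 1 := by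
  have hc : Continuous (primitiveTheta 1) := continuous_primitiveTheta.comp (.prodMk_right 1)
  have hβ : integralBeta 1 = ∫ x in (0 : ℝ)..(Real.pi / 2), lawsonBeta 1 x * lawsonU x := by
    simp [integralBeta, lawsonU]
  rw [realIterInt_one_one_u_v, realIterInt_u_v_one_one, realIterInt_one_v_u_one, hβ,
    integralBetaPrimitive, ← sub_eq_zero]
  simp only [← intervalIntegral.integral_const_mul, ← intervalIntegral.integral_neg]
  rw [← intervalIntegral.integral_add (by apply Continuous.intervalIntegrable; fun_prop)
      (by apply Continuous.intervalIntegrable; fun_prop),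
    ← intervalIntegral.integral_add (by apply Continuous.intervalIntegrable; fun_prop)
      (by apply Continuous.intervalIntegrable; fun_prop),
    ← intervalIntegral.integral_sub (by apply Continuous.intervalIntegrable; fun_prop)
      (by apply Continuous.intervalIntegrable; fun_prop),
    ← intervalIntegral.integral_sub (by apply Continuous.intervalIntegrable; fun_prop)
      (by apply Continuous.intervalIntegrable; fun_prop),
    integral_eq_sub_of_hasDerivAt_of_continuous (G := fun x => x ^ 2 / 2 * (lawsonTheta 1 x *
      lawsonBeta 1 x) - lawsonBeta 1 x * ((primitiveTheta 1 x - x * lawsonTheta 1 x) *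
        (Real.pi / 2 - x))) _ (by fun_prop)]
  · simp
  · intro x
    have hβ' := hasDerivAt_lawsonBeta_one x
    have hθ := hasDerivAt_lawsonTheta_one x
    refine ((((hasDerivAt_pow 2 x).div_const 2).fun_mul (hθ.fun_mul hβ')).sub
      (hβ'.fun_mul (((hasDerivAt_primitiveTheta 1 x).sub ((hasDerivAt_id x).mul hθ)).fun_mul
        (hasDerivAt_pi_div_two_sub x)))).congr_deriv ?_
    simp
    ring

end Words

theorem lawson_area_third_coefficient_eq_zeta_three :
    -(Complex.I / (Real.pi : ℂ) ^ 3) * OmegaValue [lawsonOmegaForm2, lawsonOmegaForm1] ^ 3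
      + 1 / (2 * (Real.pi : ℂ) ^ 2) * OmegaValue [lawsonOmegaForm2, lawsonOmegaForm1]
        * (OmegaValue [lawsonOmegaForm2, lawsonOmegaForm2, lawsonOmegaForm3]
          - 6 * OmegaValue [lawsonOmegaForm3, lawsonOmegaForm1, lawsonOmegaForm1]
          - 3 * OmegaValue [lawsonOmegaForm3, lawsonOmegaForm3, lawsonOmegaForm3])
      + Complex.I / (2 * (Real.pi : ℂ))
        * (6 * OmegaValue [lawsonOmegaForm2, lawsonOmegaForm1, lawsonOmegaForm1, lawsonOmegaForm1]
          + OmegaValue [lawsonOmegaForm2, lawsonOmegaForm2, lawsonOmegaForm2, lawsonOmegaForm1]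
          - OmegaValue [lawsonOmegaForm3, lawsonOmegaForm1, lawsonOmegaForm2, lawsonOmegaForm3]
          + OmegaValue [lawsonOmegaForm2, lawsonOmegaForm1, lawsonOmegaForm3, lawsonOmegaForm3]
          + OmegaValue [lawsonOmegaForm3, lawsonOmegaForm3, lawsonOmegaForm2, lawsonOmegaForm1])
      = (9 / 4 : ℂ) * ((∑' n : ℕ, 1 / ((n : ℝ) + 1) ^ 3 : ℝ) : ℂ) := by
  have h21 := OmegaValue_map_lawsonPullback (l := [(-2, lawsonV), (2 * Complex.I, lawsonU)])
    (by simp)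
  have h223 := OmegaValue_map_lawsonPullback
    (l := [(-2, lawsonV), (-2, lawsonV), (2 * Complex.I, fun _ => 1)])
    (by simp [continuous_const])
  have h311 := OmegaValue_map_lawsonPullback
    (l := [(2 * Complex.I, fun _ => 1), (2 * Complex.I, lawsonU), (2 * Complex.I, lawsonU)])
    (by simp [continuous_const])
  have h333 := OmegaValue_map_lawsonPullback
    (l := [(2 * Complex.I, fun _ => 1), (2 * Complex.I, fun _ => 1), (2 * Complex.I, fun _ => 1)])
    (by simp [continuous_const])
  have h2111 := OmegaValue_map_lawsonPullback
    (l := [(-2, lawsonV), (2 * Complex.I, lawsonU), (2 * Complex.I, lawsonU),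
      (2 * Complex.I, lawsonU)]) (by simp)
  have h2221 := OmegaValue_map_lawsonPullback
    (l := [(-2, lawsonV), (-2, lawsonV), (-2, lawsonV), (2 * Complex.I, lawsonU)])
    (by simp)
  have h3123 := OmegaValue_map_lawsonPullback
    (l := [(2 * Complex.I, fun _ => 1), (2 * Complex.I, lawsonU), (-2, lawsonV),
      (2 * Complex.I, fun _ => 1)]) (by simp [continuous_const])
  have h2133 := OmegaValue_map_lawsonPullback
    (l := [(-2, lawsonV), (2 * Complex.I, lawsonU), (2 * Complex.I, fun _ => 1),
      (2 * Complex.I, fun _ => 1)]) (by simp [continuous_const])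
  have h3321 := OmegaValue_map_lawsonPullback
    (l := [(2 * Complex.I, fun _ => 1), (2 * Complex.I, fun _ => 1), (-2, lawsonV),
      (2 * Complex.I, lawsonU)]) (by simp [continuous_const])
  simp only [List.map_cons, List.map_nil, List.prod_cons, List.prod_nil, List.reverse_cons,
    List.reverse_nil, List.nil_append, List.cons_append, ← lawsonOmegaForm1_eq,
    ← lawsonOmegaForm2_eq, ← lawsonOmegaForm3_eq]
    at h21 h223 h311 h333 h2111 h2221 h3123 h2133 h3321
  have hcomb := realIterInt_combination
  rw [integralBeta_one, integralBetaPrimitive_one] at hcomb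
  replace hcomb := congrArg Complex.ofReal hcomb
  rw [h21, h223, h311, h333, h2111, h2221, h3123, h2133, h3321, realIterInt_u_v,
    realIterInt_one_v_v, realIterInt_u_u_one, realIterInt_one_one_one, realIterInt_u_u_u_v,
    realIterInt_u_v_v_v, integralBeta_one, integralBetaSq_one, integralThetaSq_one,
    integralBetaCube_one, integralBetaThetaSq_one, ← realPolylog_one_right]
  push_cast at hcomb ⊢
  have hπ : (Real.pi : ℂ) ≠ 0 := by exact_mod_cast Real.pi_ne_zero
  generalize (Real.pi : ℂ) = π, (Real.log 2 : ℂ) = L, (realPolylog 3 1 : ℂ) = Z,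
    (realIterInt [fun _ => 1, lawsonV, lawsonU, fun _ => 1] (Real.pi / 2) : ℂ) = R₁,
    (realIterInt [fun _ => 1, fun _ => 1, lawsonU, lawsonV] (Real.pi / 2) : ℂ) = R₂,
    (realIterInt [lawsonU, lawsonV, fun _ => 1, fun _ => 1] (Real.pi / 2) : ℂ) = R₃ at *
  linear_combination (norm := (field_simp; ring)) (-8 / π) * hcomb +
    ((L ^ 3 + L / (2 * π) * (24 * (π ^ 3 / 48 - π / 8 * L ^ 2) + π ^ 3 / 2) +
        (-24 * (π ^ 3 / 96 * L - π / 32 * Z - π / 48 * L ^ 3) + 8 * (R₁ - R₂ - R₃)) / π) *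
      (Complex.I ^ 2 - 1) - π ^ 2 / 12 * L + Z / 8) * Complex.I_sq
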